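/- Stability of the Jack weight under padding by empty rows (Lemma 6.4): Fix θ > 0. Let λ be a partition with ℓ_λ nonzero parts, with the convention λ_i = 0 for i > ℓ_λ. Then for any integer N ≥ ℓ_λ: V_N(λ)·W_N(λ) = V_{ℓ_λ}(λ)·W_{ℓ_λ}(λ). -/

import Mathlib

open scoped BigOperators
open MeasureTheory Filter

noncomputable section

/-- `V_m(λ)` from Section 6 of Guionnet–Huang (Jack measure). Parts are indexed from 1. -/
def Vm (θ : ℝ) (lam : ℕ → ℕ) (m : ℕ) : ℝ :=
  ∏ p ∈ (Finset.Icc 1 m ×ˢ Finset.Icc 1 m).filter (fun p : ℕ × ℕ => p.1 < p.2),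
    Real.Gamma ((lam p.1 : ℝ) - lam p.2 + ((p.2 : ℝ) - p.1) * θ + 1) *
      Real.Gamma ((lam p.1 : ℝ) - lam p.2 + ((p.2 : ℝ) - p.1 + 1) * θ) /
    (Real.Gamma ((lam p.1 : ℝ) - lam p.2 + ((p.2 : ℝ) - p.1 - 1) * θ + 1) *
      Real.Gamma ((lam p.1 : ℝ) - lam p.2 + ((p.2 : ℝ) - p.1) * θ))

/-- `W_m(λ)` from Section 6 of Guionnet–Huang (Jack measure). -/
def Wm (θ : ℝ) (lam : ℕ → ℕ) (m : ℕ) : ℝ :=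
  ∏ i ∈ Finset.Icc 1 m,
    Real.Gamma θ / (Real.Gamma ((lam i : ℝ) + ((m : ℝ) - i) * θ + 1) *
      Real.Gamma ((lam i : ℝ) + ((m : ℝ) - i) * θ + θ))

/-- `f : ℕ → ℕ` encodes a partition `λ = (f 1 ≥ f 2 ≥ ⋯)` (the value `f 0` is unused
and set to `0`), with finitely many nonzero parts. -/
def IsPartitionFun (f : ℕ → ℕ) : Prop :=
  f 0 = 0 ∧ (∀ i j : ℕ, 1 ≤ i → i ≤ j → f j ≤ f i) ∧ ∃ m : ℕ, ∀ i : ℕ, m < i → f i = 0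

/-- The type of partitions. -/
def PartitionF : Type := {f : ℕ → ℕ // IsPartitionFun f}

/-- Size `|λ| = ∑ λ_i` of a partition. -/
def psize (f : ℕ → ℕ) : ℕ := ∑' i, f i

/-- `λ'_j = #{i ≥ 1 : λ_i ≥ j}`, computed with the bound `i ≤ n`. -/
def conjPart (f : ℕ → ℕ) (n j : ℕ) : ℕ := ((Finset.Icc 1 n).filter (fun i => j ≤ f i)).card

/-- `H(λ,θ) = ∏_{(i,j) ∈ λ} ((λ_i - j) + (λ'_j - i)θ + 1)` (for a partition of `n`). -/
def Hhook (θ : ℝ) (f : ℕ → ℕ) (n : ℕ) : ℝ :=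
  ∏ i ∈ Finset.Icc 1 n, ∏ j ∈ Finset.Icc 1 (f i),
    (((f i : ℝ) - j) + ((conjPart f n j : ℝ) - i) * θ + 1)

/-- `H'(λ,θ) = ∏_{(i,j) ∈ λ} ((λ_i - j) + (λ'_j - i)θ + θ)` (for a partition of `n`). -/
def Hhook' (θ : ℝ) (f : ℕ → ℕ) (n : ℕ) : ℝ :=
  ∏ i ∈ Finset.Icc 1 n, ∏ j ∈ Finset.Icc 1 (f i),
    (((f i : ℝ) - j) + ((conjPart f n j : ℝ) - i) * θ + θ)

/-- The Jack deformation of the Plancherel measure: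
`𝕄^{(n)}(λ) = n! θⁿ / (H(λ,θ) H'(λ,θ))`. -/
def Mjack (θ : ℝ) (n : ℕ) (f : ℕ → ℕ) : ℝ :=
  (n.factorial : ℝ) * θ ^ n / (Hhook θ f n * Hhook' θ f n)

/-- Probability of an event of partitions of `n` under `𝕄^{(n)}`. -/
def jackProb (θ : ℝ) (n : ℕ) (E : Set (ℕ → ℕ)) : ℝ :=
  ∑' lam : {f : PartitionF // psize f.1 = n ∧ f.1 ∈ E}, Mjack θ n lam.1.1

/-- Expectation of an observable under the Poissonized Jack measure with rate `M`:
`ℙ^{(M)}(λ) = e^{-M} M^{|λ|}/|λ|! · 𝕄^{(|λ|)}(λ)`. -/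
def poissonJackExp (θ M : ℝ) (g : (ℕ → ℕ) → ℝ) : ℝ :=
  ∑' lam : PartitionF,
    Real.exp (-M) * M ^ (psize lam.1) / (Nat.factorial (psize lam.1)) *
      Mjack θ (psize lam.1) lam.1 * g lam.1

/-- Density (up to normalization) of the Gaussian β-ensemble. -/
def gbeDensity (β : ℝ) (n : ℕ) (x : Fin n → ℝ) : ℝ :=
  (∏ p ∈ Finset.univ.filter (fun p : Fin n × Fin n => p.1 < p.2), |x p.2 - x p.1| ^ β) *
    Real.exp (-((n : ℝ) * β / 4) * ∑ i, (x i) ^ 2)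

/-- `μ` is the law of the ordered `n`-particle Gaussian β-ensemble. -/
def IsGbE (β : ℝ) (n : ℕ) (μ : MeasureTheory.Measure (Fin n → ℝ)) : Prop :=
  MeasureTheory.IsProbabilityMeasure μ ∧ ∃ Z : ℝ, 0 < Z ∧
    μ = (MeasureTheory.volume.restrict {x : Fin n → ℝ | StrictMono x}).withDensity
        (fun x => ENNReal.ofReal (gbeDensity β n x / Z))

/-- `k`-th entry (0-based) of a tuple, 0 out of range. -/
def part {N : ℕ} (x : Fin N → ℝ) (k : ℕ) : ℝ := if h : k < N then x ⟨k, h⟩ else 0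

/-- Adding the index `m + 1` multiplies `Vm` by the factors of the pairs `(i, m + 1)`. -/
theorem Vm_succ (θ : ℝ) (lam : ℕ → ℕ) (m : ℕ) :
    Vm θ lam (m + 1) = Vm θ lam m * ∏ i ∈ Finset.Icc 1 m,
      Real.Gamma ((lam i : ℝ) - lam (m + 1) + (((m + 1 : ℕ) : ℝ) - i) * θ + 1) *
        Real.Gamma ((lam i : ℝ) - lam (m + 1) + (((m + 1 : ℕ) : ℝ) - i + 1) * θ) /
      (Real.Gamma ((lam i : ℝ) - lam (m + 1) + (((m + 1 : ℕ) : ℝ) - i - 1) * θ + 1) *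
        Real.Gamma ((lam i : ℝ) - lam (m + 1) + (((m + 1 : ℕ) : ℝ) - i) * θ)) := by
  have hset : (Finset.Icc 1 (m + 1) ×ˢ Finset.Icc 1 (m + 1)).filter
        (fun p : ℕ × ℕ => p.1 < p.2) =
      (Finset.Icc 1 m ×ˢ Finset.Icc 1 m).filter (fun p : ℕ × ℕ => p.1 < p.2) ∪
        Finset.Icc 1 m ×ˢ {m + 1} := by
    ext ⟨i, j⟩
    simp only [Finset.mem_filter, Finset.mem_product, Finset.mem_Icc, Finset.mem_union,
      Finset.mem_singleton]
    omega
  have hdisj : Disjoint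
      ((Finset.Icc 1 m ×ˢ Finset.Icc 1 m).filter (fun p : ℕ × ℕ => p.1 < p.2))
      (Finset.Icc 1 m ×ˢ {m + 1}) := by
    rw [Finset.disjoint_left]
    rintro ⟨i, j⟩
    simp only [Finset.mem_filter, Finset.mem_product, Finset.mem_Icc, Finset.mem_singleton]
    omega
  rw [Vm, hset, Finset.prod_union hdisj, Finset.prod_product, Vm]
  simp only [Finset.prod_singleton]

/-- Appending one empty row does not change the Jack weight. -/
theorem Vm_mul_Wm_succ {θ : ℝ} (hθ : 0 < θ) (lam : ℕ → ℕ) (m : ℕ) (hm : lam (m + 1) = 0) :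
    Vm θ lam (m + 1) * Wm θ lam (m + 1) = Vm θ lam m * Wm θ lam m := by
  have hΓ : Real.Gamma θ ≠ 0 := (Real.Gamma_pos_of_pos hθ).ne'
  have hlast : Real.Gamma θ /
      (Real.Gamma ((lam (m + 1) : ℝ) + (((m + 1 : ℕ) : ℝ) - (m + 1 : ℕ)) * θ + 1) *
        Real.Gamma ((lam (m + 1) : ℝ) + (((m + 1 : ℕ) : ℝ) - (m + 1 : ℕ)) * θ + θ)) = 1 := by
    simp [hm, hΓ]
  rw [Vm_succ, mul_assoc, Wm, Finset.prod_Icc_succ_top (by omega), hlast, mul_one,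
    ← Finset.prod_mul_distrib, Wm]
  congr 1
  refine Finset.prod_congr rfl fun i hi => ?_
  have him : (i : ℝ) ≤ m := by exact_mod_cast (Finset.mem_Icc.mp hi).2
  have hlam : (0 : ℝ) ≤ lam i := Nat.cast_nonneg _
  have hmul : 0 ≤ ((m : ℝ) - i) * θ := mul_nonneg (sub_nonneg.mpr him) hθ.le
  simp only [hm, Nat.cast_zero, sub_zero, Nat.cast_add, Nat.cast_one]
  rw [show (lam i : ℝ) + ((m : ℝ) + 1 - i + 1) * θ = lam i + ((m : ℝ) + 1 - i) * θ + θ by ring,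
    show (lam i : ℝ) + ((m : ℝ) + 1 - i - 1) * θ + 1 = lam i + ((m : ℝ) - i) * θ + 1 by ring,
    show (lam i : ℝ) + ((m : ℝ) + 1 - i) * θ = lam i + ((m : ℝ) - i) * θ + θ by ring]
  have h₁ : Real.Gamma (lam i + ((m : ℝ) - i) * θ + θ + 1) ≠ 0 :=
    (Real.Gamma_pos_of_pos (by linarith)).ne'
  have h₂ : Real.Gamma (lam i + ((m : ℝ) - i) * θ + θ + θ) ≠ 0 :=
    (Real.Gamma_pos_of_pos (by linarith)).ne'
  have h₃ : Real.Gamma (lam i + ((m : ℝ) - i) * θ + 1) ≠ 0 :=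
    (Real.Gamma_pos_of_pos (by linarith)).ne'
  have h₄ : Real.Gamma (lam i + ((m : ℝ) - i) * θ + θ) ≠ 0 :=
    (Real.Gamma_pos_of_pos (by linarith)).ne'
  field_simp

/-- Lemma 6.4: stability of the Jack weight under padding by empty rows. -/
theorem jack_weight_padding
    (θ : ℝ) (hθ : 0 < θ) (lam : ℕ → ℕ) (llam : ℕ)
    (hmono : ∀ i j : ℕ, 1 ≤ i → i ≤ j → lam j ≤ lam i)
    (hsupp : ∀ i : ℕ, 1 ≤ i → (0 < lam i ↔ i ≤ llam)) :
    ∀ N : ℕ, llam ≤ N → Vm θ lam N * Wm θ lam N = Vm θ lam llam * Wm θ lam llam := by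
  intro N hN
  induction N, hN using Nat.le_induction with
  | base => rfl
  | succ N hN ih =>
    have hzero : lam (N + 1) = 0 := by
      have := hsupp (N + 1) (by omega)
      omega
    rw [Vm_mul_Wm_succ hθ lam N hzero, ih]
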